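/- (Proposition 2.) For every number of players m ≥ 2 and every symmetric seed budget b ≥ 1, there exists a network influence game with no pure Nash equilibrium. Concretely, there exist a finite node set V, a matrix A of nonnegative edge weights on V whose columns each sum to 1 and whose underlying digraph is strongly connected, and a threshold ε₀ ∈ (0, 1/m), such that for every ε ∈ (0, ε₀) the game with parameters α = 1/2, T = b, influence matrix Γ = (1/2)·I + (1/2)·Aᵀ, m players each choosing a strategy s_i ⊆ V with |s_i| ≤ b, initial opinions x^v_i(0) = 1/m_v(s) if v ∈ s_i, x^v_i(0) = 0 if v ∈ V_s ∖ s_i, x^v_i(0) = ε if v ∉ V_s, dynamics x_i(t) = Γ·x_i(t−1), and utilities π_i(s) = (1/|V|) Σ_{v ∈ V} x^v_i(T) / (Σ_{j} x^v_j(T)), admits no strategy profile s such that every player's strategy is a best response to the others' strategies. -/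

import Mathlib

open Finset Matrix

/-- `seedCount s u` is `m_u(s)`, the number of players that include node `u`
in their seed set. -/
def seedCount {m n : ℕ} (s : Fin m → Finset (Fin n)) (u : Fin n) : ℕ :=
  (Finset.univ.filter (fun j => u ∈ s j)).card

/-- `seeded s` is `V_s`, the set of nodes seeded by at least one player. -/
def seeded {m n : ℕ} (s : Fin m → Finset (Fin n)) : Finset (Fin n) :=
  Finset.univ.biUnion s

/-- Initial opinions: `x^v_i(0) = 1/m_v(s)` if `v ∈ s_i`, `0` if `v ∈ V_s ∖ s_i`,
and `ε` if `v ∉ V_s`. -/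
noncomputable def initOp {m n : ℕ} (ε : ℝ) (s : Fin m → Finset (Fin n)) (i : Fin m) :
    Fin n → ℝ :=
  fun v => if v ∈ s i then 1 / (seedCount s v : ℝ) else if v ∈ seeded s then 0 else ε

/-- `opinion Γ ε s i t v` is `x^v_i(t)`, obtained from `x_i(t) = Γ^t · x_i(0)`. -/
noncomputable def opinion {m n : ℕ} (Γ : Matrix (Fin n) (Fin n) ℝ) (ε : ℝ)
    (s : Fin m → Finset (Fin n)) (i : Fin m) (t : ℕ) : Fin n → ℝ :=
  (Γ ^ t).mulVec (initOp ε s i)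

/-- `payoff Γ T ε s i` is `π_i(s) = (1/|V|) Σ_{v ∈ V} x^v_i(T) / (Σ_{j ∈ M} x^v_j(T))`. -/
noncomputable def payoff {m n : ℕ} (Γ : Matrix (Fin n) (Fin n) ℝ) (T : ℕ) (ε : ℝ)
    (s : Fin m → Finset (Fin n)) (i : Fin m) : ℝ :=
  (1 / (n : ℝ)) * ∑ v : Fin n, opinion Γ ε s i T v / ∑ j : Fin m, opinion Γ ε s j T v


/-! ### Initial opinions at `ε = 0` -/

section InitialOpinions

variable {m n : ℕ} {s : Fin m → Finset (Fin n)} {i j : Fin m} {u v : Fin n}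

lemma mem_seeded : u ∈ seeded s ↔ ∃ j, u ∈ s j := by
  simp [seeded]

lemma initOp_zero (s : Fin m → Finset (Fin n)) (i : Fin m) (v : Fin n) :
    initOp 0 s i v = if v ∈ s i then 1 / (seedCount s v : ℝ) else 0 := by
  simp [initOp]

lemma seedCount_pos (h : v ∈ s i) : 0 < seedCount s v :=
  Finset.card_pos.2 ⟨i, by simpa using h⟩

lemma two_le_seedCount (hij : i ≠ j) (hi : v ∈ s i) (hj : v ∈ s j) : 2 ≤ seedCount s v :=
  Finset.one_lt_card.2 ⟨i, by simpa using hi, j, by simpa using hj, hij⟩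

lemma seedCount_eq_one (hi : v ∈ s i) (h : ∀ j ≠ i, v ∉ s j) : seedCount s v = 1 := by
  refine Finset.card_eq_one.2 ⟨i, ?_⟩
  ext j
  by_cases hj : j = i
  · simp [hj, hi]
  · simp [hj, h j hj]

lemma initOp_zero_nonneg (s : Fin m → Finset (Fin n)) (i : Fin m) (v : Fin n) :
    0 ≤ initOp 0 s i v := by
  rw [initOp_zero]; split_ifs <;> positivity

lemma initOp_zero_pos (h : v ∈ s i) : 0 < initOp 0 s i v := by
  have := seedCount_pos h
  rw [initOp_zero, if_pos h]; positivity

lemma initOp_zero_of_notMem (h : v ∉ s i) : initOp 0 s i v = 0 := by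
  rw [initOp_zero, if_neg h]

lemma initOp_zero_le_one (s : Fin m → Finset (Fin n)) (i : Fin m) (v : Fin n) :
    initOp 0 s i v ≤ 1 := by
  rw [initOp_zero]
  split_ifs with h
  · have : (1 : ℝ) ≤ seedCount s v := by exact_mod_cast seedCount_pos h
    exact div_le_one_of_le₀ this (by positivity)
  · exact zero_le_one

lemma initOp_zero_le_half (hij : i ≠ j) (hj : v ∈ s j) : initOp 0 s i v ≤ 1 / 2 := by
  rw [initOp_zero]
  split_ifs with h
  · have : (2 : ℝ) ≤ seedCount s v := by exact_mod_cast two_le_seedCount hij h hj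
    exact one_div_le_one_div_of_le (by norm_num) this
  · norm_num

lemma initOp_zero_eq_one (hi : v ∈ s i) (h : ∀ j ≠ i, v ∉ s j) : initOp 0 s i v = 1 := by
  rw [initOp_zero, if_pos hi, seedCount_eq_one hi h]; norm_num

lemma sum_initOp_zero (s : Fin m → Finset (Fin n)) (v : Fin n) :
    ∑ j, initOp 0 s j v = if v ∈ seeded s then 1 else 0 := by
  simp only [initOp_zero]
  rw [← Finset.sum_filter, Finset.sum_const, nsmul_eq_mul]
  change (seedCount s v : ℝ) * _ = _
  split_ifs with h
  · obtain ⟨j, hj⟩ := mem_seeded.1 h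
    have : (0 : ℝ) < seedCount s v := by exact_mod_cast seedCount_pos hj
    field_simp
  · have : seedCount s v = 0 := by
      refine Finset.card_eq_zero.2 (Finset.filter_eq_empty_iff.2 fun j _ hj => h ?_)
      exact mem_seeded.2 ⟨j, hj⟩
    simp [this]

lemma sum_sum_initOp_zero (s : Fin m → Finset (Fin n)) :
    ∑ j, ∑ v, initOp 0 s j v = (seeded s).card := by
  rw [Finset.sum_comm]
  simp [sum_initOp_zero]

lemma initOp_zero_congr {s' : Fin m → Finset (Fin n)} (h : ∀ j, v ∈ s j ↔ v ∈ s' j) :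
    initOp 0 s' i v = initOp 0 s i v := by
  simp only [initOp_zero, seedCount, h]

/-- A player with as many seeds as some other player holds at most half of the total mass. -/
lemma two_mul_sum_initOp_zero_le (hij : i ≠ j) (hc : (s i).card = (s j).card) :
    2 * ∑ v, initOp 0 s i v ≤ (seeded s).card := by
  have h1 : ∑ v, initOp 0 s i v ≤ ∑ v ∈ s i, (1 - if v ∈ s j then (1 / 2 : ℝ) else 0) := by
    rw [← Finset.sum_subset (Finset.subset_univ (s i))
      fun v _ hv => initOp_zero_of_notMem hv]
    refine Finset.sum_le_sum fun v _ => ?_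
    split_ifs with h
    · linarith [initOp_zero_le_half hij h]
    · linarith [initOp_zero_le_one s i v]
  have h2 : ∑ v ∈ s i, (1 - if v ∈ s j then (1 / 2 : ℝ) else 0)
      = (s i).card - (s i ∩ s j).card / 2 := by
    rw [Finset.sum_sub_distrib, ← Finset.sum_filter, Finset.filter_mem_eq_inter]
    simp [div_eq_mul_inv]
  have h3 : (s i ∪ s j).card ≤ (seeded s).card := by
    refine Finset.card_le_card fun v hv => mem_seeded.2 ?_
    rcases Finset.mem_union.1 hv with h | h
    exacts [⟨i, h⟩, ⟨j, h⟩]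
  have h4 := Finset.card_union_add_card_inter (s i) (s j)
  have h3' : ((s i ∪ s j).card : ℝ) ≤ (seeded s).card := by exact_mod_cast h3
  have h4' : ((s i ∪ s j).card : ℝ) + (s i ∩ s j).card = (s i).card + (s i).card := by
    rw [hc] at h4 ⊢; exact_mod_cast h4
  linarith

end InitialOpinions

/-! ### The limit game on a disjoint union of blocks -/

/-- `Q` is block diagonal along the fibres of `block`, all of which have size `q`, and no node
is a best reply to itself: each node `u` is outperformed inside its block by another one. -/
structure IsCyclicBlocks {n K : ℕ} (Q : Matrix (Fin n) (Fin n) ℝ) (block : Fin n → Fin K)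
    (q : ℕ) : Prop where
  pos : ∀ {v u}, block v = block u → 0 < Q v u
  zero : ∀ {v u}, block v ≠ block u → Q v u = 0
  size_pos : 0 < q
  size : ∀ k, (Finset.univ.filter fun v => block v = k).card = q
  beaten : ∀ u, ∃ u', block u' = block u ∧
    (q : ℝ) / 2 < ∑ v with block v = block u, Q v u' / (Q v u' + Q v u)

/-- The fraction of the opinion mass at `v` held by player `i` when the mass spreads by `Q` and
unseeded nodes carry no opinion. -/
noncomputable def share {m n : ℕ} (Q : Matrix (Fin n) (Fin n) ℝ) (s : Fin m → Finset (Fin n))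
    (i : Fin m) (v : Fin n) : ℝ :=
  Q.mulVec (initOp 0 s i) v / ∑ j, Q.mulVec (initOp 0 s j) v

/-- Some player seeds a node of block `k`. -/
def Hit {m n K : ℕ} (block : Fin n → Fin K) (s : Fin m → Finset (Fin n)) (k : Fin K) : Prop :=
  ∃ j, ∃ u ∈ s j, block u = k

/-- The fraction of all seeds held by player `i`. -/
noncomputable def seedShare {m n : ℕ} (s : Fin m → Finset (Fin n)) (i : Fin m) : ℝ :=
  (∑ v, initOp 0 s i v) / (seeded s).card

open Classical in
/-- The share of player `i` at `v` when blocks are joined by infinitesimal uniform links. -/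
noncomputable def limitShare {m n K : ℕ} (Q : Matrix (Fin n) (Fin n) ℝ) (block : Fin n → Fin K)
    (s : Fin m → Finset (Fin n)) (i : Fin m) (v : Fin n) : ℝ :=
  if Hit block s (block v) then share Q s i v else seedShare s i

/-- The payoff of player `i` collected in block `k` in the limit game. -/
noncomputable def blockValue {m n K : ℕ} (Q : Matrix (Fin n) (Fin n) ℝ) (block : Fin n → Fin K)
    (s : Fin m → Finset (Fin n)) (i : Fin m) (k : Fin K) : ℝ :=
  ∑ v with block v = k, limitShare Q block s i v

section Blocks

variable {m n K q : ℕ} {Q : Matrix (Fin n) (Fin n) ℝ} {block : Fin n → Fin K}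
  {s s' : Fin m → Finset (Fin n)} {i j : Fin m} {u v e : Fin n} {k : Fin K}

lemma seedShare_nonneg (s : Fin m → Finset (Fin n)) (i : Fin m) : 0 ≤ seedShare s i :=
  div_nonneg (Finset.sum_nonneg fun v _ => initOp_zero_nonneg s i v) (by positivity)

lemma seedShare_le_half (hij : i ≠ j) (hc : (s i).card = (s j).card) :
    seedShare s i ≤ 1 / 2 := by
  have h := two_mul_sum_initOp_zero_le hij hc
  exact div_le_of_le_mul₀ (by positivity) (by norm_num) (by linarith)

lemma seedShare_lt_one (hij : i ≠ j) (hu : u ∈ s j) : seedShare s i < 1 := by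
  have hN : (0 : ℝ) < (seeded s).card := by
    exact_mod_cast Finset.card_pos.2 ⟨u, mem_seeded.2 ⟨j, hu⟩⟩
  rw [seedShare, div_lt_one hN, ← sum_sum_initOp_zero]
  have hj : 0 < ∑ v, initOp 0 s j v :=
    Finset.sum_pos' (fun v _ => initOp_zero_nonneg s j v) ⟨u, Finset.mem_univ _, initOp_zero_pos hu⟩
  exact Finset.single_lt_sum (f := fun l => ∑ v, initOp 0 s l v) hij.symm (Finset.mem_univ _)
    (Finset.mem_univ _) hj fun l _ _ => Finset.sum_nonneg fun v _ => initOp_zero_nonneg s l v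

lemma blockValue_of_hit (h : Hit block s k) :
    blockValue Q block s i k = ∑ v with block v = k, share Q s i v := by
  refine Finset.sum_congr rfl fun v hv => if_pos ?_
  rwa [(Finset.mem_filter.1 hv).2]

namespace IsCyclicBlocks

variable (hQ : IsCyclicBlocks Q block q)

include hQ

lemma nonneg (v u : Fin n) : 0 ≤ Q v u := by
  by_cases h : block v = block u
  · exact (hQ.pos h).le
  · exact (hQ.zero h).ge

lemma mass_nonneg (s : Fin m → Finset (Fin n)) (i : Fin m) (v : Fin n) :
    0 ≤ Q.mulVec (initOp 0 s i) v := by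
  rw [Matrix.mulVec, dotProduct]
  exact Finset.sum_nonneg fun u _ => mul_nonneg (hQ.nonneg v u) (initOp_zero_nonneg s i u)

lemma mass_pos (hu : u ∈ s i) (h : block v = block u) : 0 < Q.mulVec (initOp 0 s i) v := by
  rw [Matrix.mulVec, dotProduct]
  exact Finset.sum_pos' (fun u _ => mul_nonneg (hQ.nonneg v u) (initOp_zero_nonneg s i u))
    ⟨u, Finset.mem_univ _, mul_pos (hQ.pos h) (initOp_zero_pos hu)⟩

lemma mass_eq_zero (h : ∀ u ∈ s i, block u ≠ block v) : Q.mulVec (initOp 0 s i) v = 0 := by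
  rw [Matrix.mulVec, dotProduct]
  refine Finset.sum_eq_zero fun u _ => ?_
  by_cases hu : u ∈ s i
  · rw [hQ.zero (h u hu).symm, zero_mul]
  · rw [initOp_zero_of_notMem hu, mul_zero]

lemma sum_mass_pos (h : Hit block s (block v)) : 0 < ∑ j, Q.mulVec (initOp 0 s j) v := by
  obtain ⟨j, u, hu, huv⟩ := h
  exact Finset.sum_pos' (fun j _ => hQ.mass_nonneg s j v)
    ⟨j, Finset.mem_univ _, hQ.mass_pos hu huv.symm⟩

lemma blockValue_of_not_hit (h : ¬ Hit block s k) :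
    blockValue Q block s i k = q * seedShare s i := by
  rw [← hQ.size k, ← nsmul_eq_mul, ← Finset.sum_const]
  refine Finset.sum_congr rfl fun v hv => if_neg ?_
  rwa [(Finset.mem_filter.1 hv).2]

lemma share_nonneg (s : Fin m → Finset (Fin n)) (i : Fin m) (v : Fin n) : 0 ≤ share Q s i v :=
  div_nonneg (hQ.mass_nonneg s i v) (Finset.sum_nonneg fun j _ => hQ.mass_nonneg s j v)

lemma blockValue_nonneg (s : Fin m → Finset (Fin n)) (i : Fin m) (k : Fin K) :
    0 ≤ blockValue Q block s i k := by
  refine Finset.sum_nonneg fun v _ => ?_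
  unfold limitShare
  split_ifs
  exacts [hQ.share_nonneg s i v, seedShare_nonneg s i]

lemma sum_blockValue (h : Hit block s k) : ∑ i, blockValue Q block s i k = q := by
  simp only [blockValue_of_hit h]
  rw [Finset.sum_comm, ← hQ.size k, Finset.cast_card]
  refine Finset.sum_congr rfl fun v hv => ?_
  simp only [share]
  rw [← Finset.sum_div, div_self]
  refine (hQ.sum_mass_pos ?_).ne'
  rwa [(Finset.mem_filter.1 hv).2]

lemma blockValue_pos (hu : u ∈ s i) : 0 < blockValue Q block s i (block u) := by
  have h : Hit block s (block u) := ⟨i, u, hu, rfl⟩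
  rw [blockValue_of_hit h]
  refine Finset.sum_pos' (fun v _ => hQ.share_nonneg s i v) ⟨u, by simp, ?_⟩
  exact div_pos (hQ.mass_pos hu rfl) (hQ.sum_mass_pos h)

lemma blockValue_eq_zero (h : Hit block s k) (hi : ∀ u ∈ s i, block u ≠ k) :
    blockValue Q block s i k = 0 := by
  rw [blockValue_of_hit h]
  refine Finset.sum_eq_zero fun v hv => ?_
  rw [share, hQ.mass_eq_zero, zero_div]
  rwa [(Finset.mem_filter.1 hv).2]

lemma blockValue_eq_size (hu : u ∈ s i) (h : ∀ j ≠ i, ∀ u' ∈ s j, block u' ≠ block u) :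
    blockValue Q block s i (block u) = q := by
  have hk : Hit block s (block u) := ⟨i, u, hu, rfl⟩
  rw [← hQ.sum_blockValue hk]
  exact (Finset.sum_eq_single i (fun j _ hj => hQ.blockValue_eq_zero hk (h j hj))
    (by simp)).symm

lemma blockValue_add_le (hij : i ≠ j) (h : Hit block s k) :
    blockValue Q block s i k + blockValue Q block s j k ≤ q := by
  rw [← hQ.sum_blockValue h, ← Finset.sum_pair (f := fun l => blockValue Q block s l k) hij]
  exact Finset.sum_le_sum_of_subset_of_nonneg (Finset.subset_univ _)
    fun l _ _ => hQ.blockValue_nonneg s l k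

lemma blockValue_congr (h : Hit block s k) (hs : ∀ j u, block u = k → (u ∈ s j ↔ u ∈ s' j)) :
    blockValue Q block s' i k = blockValue Q block s i k := by
  have h' : Hit block s' k := by
    obtain ⟨j, u, hu, huk⟩ := h
    exact ⟨j, u, (hs j u huk).1 hu, huk⟩
  rw [blockValue_of_hit h, blockValue_of_hit h']
  refine Finset.sum_congr rfl fun v hv => ?_
  have hmass : ∀ j, Q.mulVec (initOp 0 s' j) v = Q.mulVec (initOp 0 s j) v := fun j => by
    simp only [Matrix.mulVec, dotProduct]
    refine Finset.sum_congr rfl fun u _ => ?_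
    by_cases huv : block v = block u
    · rw [initOp_zero_congr fun l => hs l u (huv ▸ (Finset.mem_filter.1 hv).2)]
    · rw [hQ.zero huv, zero_mul, zero_mul]
  simp only [share, hmass]

lemma mass_eq_of_single (hu : block v = block u)
    (hs : ∀ w, block w = block u → (w ∈ s i ↔ w = u)) (hs' : ∀ j ≠ i, u ∉ s j) :
    Q.mulVec (initOp 0 s i) v = Q v u := by
  rw [Matrix.mulVec, dotProduct]
  refine (Finset.sum_eq_single u (fun w _ hw => ?_) (by simp)).trans ?_
  · by_cases hvw : block v = block w
    · rw [initOp_zero_of_notMem, mul_zero]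
      rwa [hs w (hvw.symm.trans hu)]
    · rw [hQ.zero hvw, zero_mul]
  · rw [initOp_zero_eq_one ((hs u rfl).2 rfl) hs', mul_one]

/-- The value of a block in which exactly two nodes are seeded, by one player each. -/
lemma blockValue_duel {u' : Fin n} (hij : i ≠ j) (hk : block u' = block u) (hne : u' ≠ u)
    (hi : ∀ w, block w = block u → (w ∈ s i ↔ w = u'))
    (hj : ∀ w, block w = block u → (w ∈ s j ↔ w = u))
    (hl : ∀ l, l ≠ i → l ≠ j → ∀ w ∈ s l, block w ≠ block u) :
    blockValue Q block s i (block u) =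
      ∑ v with block v = block u, Q v u' / (Q v u' + Q v u) := by
  rw [blockValue_of_hit ⟨j, u, (hj u rfl).2 rfl, rfl⟩]
  refine Finset.sum_congr rfl fun v hv => ?_
  replace hv := (Finset.mem_filter.1 hv).2
  have h1 : Q.mulVec (initOp 0 s i) v = Q v u' := by
    refine hQ.mass_eq_of_single (hv.trans hk.symm) (by rwa [hk]) fun l hl' hmem => ?_
    by_cases hlj : l = j
    · rw [hlj, hj u' hk] at hmem
      exact hne hmem
    · exact hl l hl' hlj u' hmem hk
  have h2 : Q.mulVec (initOp 0 s j) v = Q v u := by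
    refine hQ.mass_eq_of_single hv hj fun l hl' hmem => ?_
    by_cases hli : l = i
    · rw [hli, hi u rfl] at hmem
      exact hne hmem.symm
    · exact hl l hli hl' u hmem rfl
  have h3 : ∑ l, Q.mulVec (initOp 0 s l) v = Q v u' + Q v u := by
    rw [Finset.sum_eq_add i j hij, h1, h2]
    · exact fun l _ h => hQ.mass_eq_zero (by rw [hv]; exact hl l h.1 h.2)
    · simp
    · simp
  rw [share, h1, h3]

end IsCyclicBlocks

end Blocks

/-- The profile `s` with the seed `u` of player `i` (if present) replaced by `e`. -/
def relocate {m n : ℕ} (s : Fin m → Finset (Fin n)) (i : Fin m) (u e : Fin n) :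
    Fin m → Finset (Fin n) :=
  Function.update s i (insert e ((s i).erase u))

/-- Some player strictly gains in the limit game by deviating within the seed budget `b`. -/
def CanImprove {m n K : ℕ} (Q : Matrix (Fin n) (Fin n) ℝ) (block : Fin n → Fin K) (b : ℕ)
    (s : Fin m → Finset (Fin n)) : Prop :=
  ∃ (i : Fin m) (s' : Finset (Fin n)), s'.card ≤ b ∧
    ∑ k, blockValue Q block s i k < ∑ k, blockValue Q block (Function.update s i s') i k

section Relocate

variable {m n K q b : ℕ} {Q : Matrix (Fin n) (Fin n) ℝ} {block : Fin n → Fin K}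
  {s : Fin m → Finset (Fin n)} {i j : Fin m} {u v w e : Fin n} {k : Fin K}

lemma mem_relocate_self : w ∈ relocate s i u e i ↔ w = e ∨ w ≠ u ∧ w ∈ s i := by
  simp [relocate]

lemma mem_relocate_of_ne (h : j ≠ i) : w ∈ relocate s i u e j ↔ w ∈ s j := by
  simp [relocate, h]

lemma mem_relocate_iff (he : w ≠ e) (hu : w ≠ u) (j : Fin m) :
    w ∈ s j ↔ w ∈ relocate s i u e j := by
  by_cases h : j = i
  · subst h; simp [mem_relocate_self, he, hu]
  · rw [mem_relocate_of_ne h]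

lemma eq_or_mem_of_mem_relocate (h : w ∈ relocate s i u e j) : w = e ∨ w ∈ s j := by
  by_cases hj : j = i
  · subst hj
    rw [mem_relocate_self] at h
    tauto
  · exact Or.inr ((mem_relocate_of_ne hj).1 h)

lemma card_insert_erase_le (hs : (s i).card ≤ b) (h : u ∈ s i ∨ (s i).card < b) :
    (insert e ((s i).erase u)).card ≤ b := by
  have h1 := Finset.card_insert_le e ((s i).erase u)
  rcases h with h | h
  · have := Finset.card_erase_add_one h
    omega
  · have := Finset.card_erase_le (s := s i) (a := u)
    omega

lemma canImprove_of_relocate (hs : (s i).card ≤ b) (h : u ∈ s i ∨ (s i).card < b)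
    (hlt : ∑ k, blockValue Q block s i k < ∑ k, blockValue Q block (relocate s i u e) i k) :
    CanImprove Q block b s :=
  ⟨i, _, card_insert_erase_le hs h, hlt⟩

lemma sum_initOp_relocate_ge (he : e ∉ seeded s) :
    ∑ v, initOp 0 s i v + 1 - initOp 0 s i u ≤ ∑ v, initOp 0 (relocate s i u e) i v := by
  have h : ∑ v, (initOp 0 s i v + (if v = e then 1 else 0) - if v = u then initOp 0 s i u else 0)
      = ∑ v, initOp 0 s i v + 1 - initOp 0 s i u := by
    simp [Finset.sum_add_distrib, Finset.sum_sub_distrib]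
  rw [← h]
  refine Finset.sum_le_sum fun v _ => ?_
  have he' : ∀ j, e ∉ s j := fun j hj => he (mem_seeded.2 ⟨j, hj⟩)
  by_cases hve : v = e
  · subst hve
    rw [initOp_zero_eq_one (mem_relocate_self.2 (Or.inl rfl))
      fun j hj hv => he' j ((mem_relocate_of_ne hj).1 hv), initOp_zero_of_notMem (he' i), if_pos rfl]
    split_ifs
    · linarith [initOp_zero_nonneg s i u]
    · norm_num
  · by_cases hvu : v = u
    · subst hvu
      simpa [hve] using initOp_zero_nonneg _ _ _
    · rw [initOp_zero_congr (mem_relocate_iff hve hvu)]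
      simp [hve, hvu]

/-- Moving a seed to a fresh node does not lower the seed share of a player holding at most half
of the total mass; neither does adding a fresh seed. -/
lemma seedShare_le_relocate (he : e ∉ seeded s)
    (h : u = e ∨ 2 * ∑ v, initOp 0 s i v ≤ (seeded s).card) :
    seedShare s i ≤ seedShare (relocate s i u e) i := by
  set x := ∑ v, initOp 0 s i v with hx
  have hx' := sum_initOp_relocate_ge (i := i) (u := u) he
  rw [← hx] at hx'
  have hx0 : 0 ≤ x := Finset.sum_nonneg fun v _ => initOp_zero_nonneg s i v
  have hxN : x ≤ (seeded s).card := by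
    rw [← sum_sum_initOp_zero]
    exact Finset.single_le_sum (f := fun j => ∑ v, initOp 0 s j v)
      (fun j _ => Finset.sum_nonneg fun v _ => initOp_zero_nonneg s j v) (Finset.mem_univ i)
  have hN' : (0 : ℝ) < (seeded (relocate s i u e)).card := by
    exact_mod_cast Finset.card_pos.2 ⟨e, mem_seeded.2 ⟨i, mem_relocate_self.2 (Or.inl rfl)⟩⟩
  have hsub : seeded (relocate s i u e) ⊆ insert e (seeded s) := by
    intro w hw
    obtain ⟨j, hj⟩ := mem_seeded.1 hw
    rcases eq_or_mem_of_mem_relocate hj with h | h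
    · simp [h]
    · exact Finset.mem_insert_of_mem (mem_seeded.2 ⟨j, h⟩)
  have hle : ((seeded (relocate s i u e)).card : ℝ) ≤ (seeded s).card + 1 := by
    exact_mod_cast (Finset.card_le_card hsub).trans (Finset.card_insert_le _ _)
  unfold seedShare
  rw [← hx]
  rcases eq_or_ne (seeded s).card 0 with hN | hN
  · rw [hN, Nat.cast_zero, div_zero]
    exact seedShare_nonneg _ _
  have hN : (0 : ℝ) < (seeded s).card := by positivity
  rw [div_le_div_iff₀ hN hN']
  have he' : ∀ j, e ∉ s j := fun j hj => he (mem_seeded.2 ⟨j, hj⟩)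
  rcases h with rfl | h
  · rw [initOp_zero_of_notMem (he' i)] at hx'
    nlinarith
  by_cases hu : ∀ j ≠ i, u ∉ s j
  · by_cases hui : u ∈ s i
    · rw [initOp_zero_eq_one hui hu] at hx'
      have hsub' : seeded (relocate s i u e) ⊆ insert e ((seeded s).erase u) := by
        intro w hw
        obtain ⟨j, hj⟩ := mem_seeded.1 hw
        by_cases hwe : w = e
        · simp [hwe]
        refine Finset.mem_insert_of_mem (Finset.mem_erase.2 ⟨?_, ?_⟩)
        · rintro rfl
          by_cases hji : j = i
          · subst hji
            simp [mem_relocate_self, hwe] at hj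
          · exact hu j hji ((mem_relocate_of_ne hji).1 hj)
        · exact mem_seeded.2 ⟨j, (eq_or_mem_of_mem_relocate hj).resolve_left hwe⟩
      have hle' : ((seeded (relocate s i u e)).card : ℝ) ≤ (seeded s).card := by
        have h1 := (Finset.card_le_card hsub').trans (Finset.card_insert_le _ _)
        rw [Finset.card_erase_add_one (mem_seeded.2 ⟨i, hui⟩)] at h1
        exact_mod_cast h1
      nlinarith
    · rw [initOp_zero_of_notMem hui] at hx'
      nlinarith
  · push Not at hu
    obtain ⟨j, hj, huj⟩ := hu
    have := initOp_zero_le_half (Ne.symm hj) huj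
    nlinarith

namespace IsCyclicBlocks

variable (hQ : IsCyclicBlocks Q block q)

include hQ

lemma blockValue_relocate_of_hit (hk : Hit block s k) (he : k ≠ block e) (hu : k ≠ block u) :
    blockValue Q block (relocate s i u e) i k = blockValue Q block s i k :=
  hQ.blockValue_congr hk fun j w hw =>
    mem_relocate_iff (by rintro rfl; exact he hw.symm) (by rintro rfl; exact hu hw.symm) j

lemma blockValue_le_relocate (hes : e ∉ seeded s)
    (h : u = e ∨ 2 * ∑ v, initOp 0 s i v ≤ (seeded s).card)
    (he : k ≠ block e) (hu : k ≠ block u) :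
    blockValue Q block s i k ≤ blockValue Q block (relocate s i u e) i k := by
  by_cases hk : Hit block s k
  · exact (hQ.blockValue_relocate_of_hit hk he hu).ge
  · have hk' : ¬ Hit block (relocate s i u e) k := by
      rintro ⟨j, w, hw, hwk⟩
      rcases eq_or_mem_of_mem_relocate hw with rfl | hw
      · exact he hwk.symm
      · exact hk ⟨j, w, hw, hwk⟩
    rw [hQ.blockValue_of_not_hit hk, hQ.blockValue_of_not_hit hk']
    gcongr
    exact seedShare_le_relocate hes h

lemma exists_block_eq (k : Fin K) : ∃ v, block v = k := by
  have h : 0 < (Finset.univ.filter fun v => block v = k).card := by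
    rw [hQ.size k]; exact hQ.size_pos
  obtain ⟨v, hv⟩ := Finset.card_pos.1 h
  exact ⟨v, (Finset.mem_filter.1 hv).2⟩

lemma blockValue_of_unique_owner (hu : u ∈ s i) (hk : block u = k)
    (h : ∀ j ≠ i, ∀ u' ∈ s j, block u' ≠ k) : blockValue Q block s i k = q := by
  subst hk
  exact hQ.blockValue_eq_size hu h

lemma blockValue_relocate_of_not_hit (he : ¬ Hit block s (block e)) :
    blockValue Q block (relocate s i u e) i (block e) = q :=
  hQ.blockValue_eq_size (mem_relocate_self.2 (Or.inl rfl)) fun j hj w hw hwe =>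
    he ⟨j, w, (mem_relocate_of_ne hj).1 hw, hwe⟩

/-- A player with a spare seed profits from placing it in an empty block. -/
lemma canImprove_of_spare (hij : i ≠ j) (hc : (s i).card < b) (hv : v ∈ s j)
    (he : ¬ Hit block s k) : CanImprove Q block b s := by
  obtain ⟨e, rfl⟩ := hQ.exists_block_eq k
  have hes : e ∉ seeded s := fun h => by
    obtain ⟨l, hl⟩ := mem_seeded.1 h
    exact he ⟨l, e, hl, rfl⟩
  have hq : (0 : ℝ) < q := by exact_mod_cast hQ.size_pos
  refine canImprove_of_relocate (u := e) (e := e) hc.le (Or.inr hc) ?_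
  have hlt : blockValue Q block s i (block e) <
      blockValue Q block (relocate s i e e) i (block e) := by
    rw [hQ.blockValue_of_not_hit he, hQ.blockValue_relocate_of_not_hit he]
    nlinarith [seedShare_lt_one hij hv]
  refine Finset.sum_lt_sum (fun k _ => ?_) ⟨block e, Finset.mem_univ _, hlt⟩
  rcases eq_or_ne k (block e) with rfl | hk
  · exact hlt.le
  · exact hQ.blockValue_le_relocate hes (Or.inl rfl) hk hk

/-- Moving a seed worth less than half a block to an empty block is profitable. -/
lemma canImprove_of_loss_lt_half (hij : i ≠ j) (hi : (s i).card = b) (hj : (s j).card = b)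
    (hu : u ∈ s i) (he : ¬ Hit block s k)
    (hloss : ∀ e, block e = k → blockValue Q block s i (block u) -
      blockValue Q block (relocate s i u e) i (block u) < q / 2) :
    CanImprove Q block b s := by
  obtain ⟨e, rfl⟩ := hQ.exists_block_eq k
  have hes : e ∉ seeded s := fun h => by
    obtain ⟨l, hl⟩ := mem_seeded.1 h
    exact he ⟨l, e, hl, rfl⟩
  have hne : block u ≠ block e := fun h => he ⟨i, u, hu, h⟩
  refine canImprove_of_relocate (u := u) (e := e) hi.le (Or.inl hu) ?_
  have hloss := hloss e rfl
  have h1 := hQ.blockValue_of_not_hit (i := i) he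
  have h2 := hQ.blockValue_relocate_of_not_hit (i := i) (u := u) he
  have h3 := seedShare_le_half hij (hi.trans hj.symm)
  have hq : (0 : ℝ) < q := by exact_mod_cast hQ.size_pos
  rw [← Finset.add_sum_erase _ _ (Finset.mem_univ (block u)),
    ← Finset.add_sum_erase _ _ (Finset.mem_erase.2 ⟨hne.symm, Finset.mem_univ (block e)⟩),
    ← Finset.add_sum_erase _ _ (Finset.mem_univ (block u)),
    ← Finset.add_sum_erase _ _ (Finset.mem_erase.2 ⟨hne.symm, Finset.mem_univ (block e)⟩)]
  have hrest := Finset.sum_le_sum (s := (Finset.univ.erase (block u)).erase (block e))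
    (f := fun k => blockValue Q block s i k)
    (g := fun k => blockValue Q block (relocate s i u e) i k) fun k hk => by
      simp only [Finset.mem_erase] at hk
      exact hQ.blockValue_le_relocate hes
        (Or.inr (two_mul_sum_initOp_zero_le hij (hi.trans hj.symm))) hk.1 hk.2.1
  nlinarith

/-- A player who does not win a block contested by single seeds of two players can improve. -/
lemma canImprove_of_duel {u₀ : Fin n} (hij : i ≠ j) (hi : (s i).card = b) (hj : (s j).card = b)
    (hk : block u = block u₀)
    (hui : ∀ w, block w = block u₀ → (w ∈ s i ↔ w = u))
    (huj : ∀ w, block w = block u₀ → (w ∈ s j ↔ w = u₀))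
    (hl : ∀ l, l ≠ i → l ≠ j → ∀ w ∈ s l, block w ≠ block u₀)
    (hval : blockValue Q block s i (block u₀) ≤ q / 2) :
    CanImprove Q block b s := by
  obtain ⟨e, he, hbeat⟩ := hQ.beaten u₀
  have heu₀ : e ≠ u₀ := by
    rintro rfl
    refine hbeat.ne' ?_
    have : ∀ v ∈ Finset.univ.filter (fun v => block v = block e),
        Q v e / (Q v e + Q v e) = 1 / 2 := fun v hv => by
      have := hQ.pos (Finset.mem_filter.1 hv).2
      field_simp
      norm_num
    rw [Finset.sum_congr rfl this, Finset.sum_const, hQ.size, nsmul_eq_mul]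
    ring
  have heu : e ≠ u := by
    rintro rfl
    rw [hQ.blockValue_duel hij he heu₀ hui huj hl] at hval
    linarith
  have hes : e ∉ seeded s := fun h => by
    obtain ⟨l, hel⟩ := mem_seeded.1 h
    by_cases hli : l = i
    · rw [hli, hui e he] at hel
      exact heu hel
    by_cases hlj : l = j
    · rw [hlj, huj e he] at hel
      exact heu₀ hel
    exact hl l hli hlj e hel he
  have hu : u ∈ s i := (hui u hk).2 rfl
  refine canImprove_of_relocate (u := u) (e := e) hi.le (Or.inl hu) ?_
  have hduel : blockValue Q block (relocate s i u e) i (block u₀) =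
      ∑ v with block v = block u₀, Q v e / (Q v e + Q v u₀) := by
    refine hQ.blockValue_duel hij he heu₀ (fun w hw => ?_) (fun w hw => ?_) fun l h1 h2 w hw => ?_
    · rw [mem_relocate_self, hui w hw]
      tauto
    · rw [mem_relocate_of_ne hij.symm, huj w hw]
    · exact hl l h1 h2 w ((mem_relocate_of_ne h1).1 hw)
  have hlt : blockValue Q block s i (block u₀) <
      blockValue Q block (relocate s i u e) i (block u₀) := by
    rw [hduel]; linarith
  refine Finset.sum_lt_sum (fun k _ => ?_) ⟨block u₀, Finset.mem_univ _, hlt⟩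
  rcases eq_or_ne k (block u₀) with rfl | hk'
  · exact hlt.le
  · exact hQ.blockValue_le_relocate hes
      (Or.inr (two_mul_sum_initOp_zero_le hij (hi.trans hj.symm))) (by rwa [he]) (by rwa [hk])

/-- A player profits from copying an opponent's seed in a block where the player has none, if
no other block is affected. -/
lemma canImprove_of_copy (hs : (s i).card ≤ b) (hu : u ∈ s i ∨ (s i).card < b)
    (hej : e ∈ s j) (hei : ∀ w ∈ s i, block w ≠ block e)
    (hhit : ∀ k, Hit block s k)
    (hle : block u ≠ block e → blockValue Q block s i (block u) ≤
      blockValue Q block (relocate s i u e) i (block u)) :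
    CanImprove Q block b s := by
  refine canImprove_of_relocate (u := u) (e := e) hs hu ?_
  have hlt : blockValue Q block s i (block e) <
      blockValue Q block (relocate s i u e) i (block e) := by
    rw [hQ.blockValue_eq_zero ⟨j, e, hej, rfl⟩ hei]
    exact hQ.blockValue_pos (mem_relocate_self.2 (Or.inl rfl))
  refine Finset.sum_lt_sum (fun k _ => ?_) ⟨block e, Finset.mem_univ _, hlt⟩
  rcases eq_or_ne k (block e) with rfl | hk
  · exact hlt.le
  rcases eq_or_ne k (block u) with rfl | hk'
  · exact hle hk
  · exact (hQ.blockValue_relocate_of_hit (hhit k) hk hk').ge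

end IsCyclicBlocks

end Relocate

/-- The seeds of player `j` in block `k`. -/
def blockSeeds {m n K : ℕ} (block : Fin n → Fin K) (s : Fin m → Finset (Fin n)) (k : Fin K)
    (j : Fin m) : Finset (Fin n) :=
  (s j).filter fun u => block u = k

section Improvement

variable {m n K q b : ℕ} {Q : Matrix (Fin n) (Fin n) ℝ} {block : Fin n → Fin K}
  {s : Fin m → Finset (Fin n)} {i j l : Fin m} {u v : Fin n} {k : Fin K}

lemma mem_blockSeeds : u ∈ blockSeeds block s k j ↔ u ∈ s j ∧ block u = k :=
  Finset.mem_filter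

lemma sum_sum_card_blockSeeds :
    ∑ k, ∑ j, (blockSeeds block s k j).card = ∑ j, (s j).card := by
  rw [Finset.sum_comm]
  exact Finset.sum_congr rfl fun j _ =>
    (Finset.card_eq_sum_card_fiberwise fun _ _ => Finset.mem_univ _).symm

lemma card_blockSeeds_add_le (hij : i ≠ j) :
    (blockSeeds block s k i).card + (blockSeeds block s k j).card ≤
      ∑ j, (blockSeeds block s k j).card := by
  rw [← Finset.sum_pair (f := fun l => (blockSeeds block s k l).card) hij]
  exact Finset.sum_le_sum_of_subset (Finset.subset_univ _)

lemma card_blockSeeds_add_add_le (hij : i ≠ j) (hil : i ≠ l) (hjl : j ≠ l) :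
    (blockSeeds block s k i).card + ((blockSeeds block s k j).card +
      (blockSeeds block s k l).card) ≤ ∑ j, (blockSeeds block s k j).card := by
  rw [← Finset.sum_pair (f := fun l => (blockSeeds block s k l).card) hjl,
    ← Finset.sum_insert (f := fun l => (blockSeeds block s k l).card) (by simp [hij, hil])]
  exact Finset.sum_le_sum_of_subset (Finset.subset_univ _)

lemma one_le_sum_card_blockSeeds (h : Hit block s k) :
    1 ≤ ∑ j, (blockSeeds block s k j).card := by
  obtain ⟨j, u, hu, huk⟩ := h
  exact (Finset.card_pos.2 ⟨u, mem_blockSeeds.2 ⟨hu, huk⟩⟩).trans_le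
    (Finset.single_le_sum (f := fun j => (blockSeeds block s k j).card) (fun _ _ => Nat.zero_le _)
      (Finset.mem_univ j))

/-- Positive integers indexed by `Fin K`: the excess over `1` of two terms is at most the excess
of the sum over `K`. -/
lemma add_le_of_one_le {K : ℕ} {f : Fin K → ℕ} (hf : ∀ k, 1 ≤ f k) {k k' : Fin K} (h : k ≠ k') :
    f k + f k' + K ≤ ∑ k, f k + 2 := by
  have h1 : ∑ k, f k = f k + (f k' + ∑ x ∈ (Finset.univ.erase k).erase k', f x) := by
    rw [Finset.add_sum_erase _ _ (Finset.mem_erase.2 ⟨h.symm, Finset.mem_univ k'⟩),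
      Finset.add_sum_erase _ _ (Finset.mem_univ k)]
  have h2 : _ ≤ ∑ x ∈ (Finset.univ.erase k).erase k', f x :=
    Finset.card_nsmul_le_sum _ f 1 fun x _ => hf x
  rw [Finset.card_erase_of_mem (Finset.mem_erase.2 ⟨h.symm, Finset.mem_univ k'⟩),
    Finset.card_erase_of_mem (Finset.mem_univ k), Finset.card_univ, Fintype.card_fin,
    smul_eq_mul] at h2
  omega

lemma le_of_one_le {K : ℕ} {f : Fin K → ℕ} (hf : ∀ k, 1 ≤ f k) (k : Fin K) :
    f k + K ≤ ∑ k, f k + 1 := by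
  have h1 : ∑ k, f k = f k + ∑ x ∈ Finset.univ.erase k, f x :=
    (Finset.add_sum_erase _ _ (Finset.mem_univ k)).symm
  have h2 : _ ≤ ∑ x ∈ Finset.univ.erase k, f x :=
    Finset.card_nsmul_le_sum _ f 1 fun x _ => hf x
  rw [Finset.card_erase_of_mem (Finset.mem_univ k), Finset.card_univ, Fintype.card_fin,
    smul_eq_mul] at h2
  omega

namespace IsCyclicBlocks

variable (hQ : IsCyclicBlocks Q block q)

include hQ

lemma blockValue_add_lt (hij : i ≠ j) (hil : i ≠ l) (hjl : j ≠ l)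
    (hu : u ∈ blockSeeds block s k l) :
    blockValue Q block s i k + blockValue Q block s j k < q := by
  obtain ⟨hus, huk⟩ := mem_blockSeeds.1 hu
  subst huk
  have hsum : blockValue Q block s i (block u) + (blockValue Q block s j (block u) +
      blockValue Q block s l (block u)) ≤ q := by
    rw [← hQ.sum_blockValue ⟨l, u, hus, rfl⟩,
      ← Finset.sum_pair (f := fun l => blockValue Q block s l (block u)) hjl,
      ← Finset.sum_insert (f := fun l => blockValue Q block s l (block u)) (by simp [hij, hil])]
    exact Finset.sum_le_sum_of_subset_of_nonneg (Finset.subset_univ _)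
      fun l _ _ => hQ.blockValue_nonneg s l _
  linarith [hQ.blockValue_pos hus]

lemma canImprove_of_two_singles (hij : i ≠ j) (hi : (s i).card = b) (hj : (s j).card = b)
    (hci : (blockSeeds block s k i).card = 1) (hcj : (blockSeeds block s k j).card = 1)
    (hl : ∀ l, l ≠ i → l ≠ j → blockSeeds block s k l = ∅) : CanImprove Q block b s := by
  obtain ⟨u, hu⟩ := Finset.card_eq_one.1 hci
  obtain ⟨v, hv⟩ := Finset.card_eq_one.1 hcj
  have hui : ∀ w, block w = k → (w ∈ s i ↔ w = u) := fun w hw => by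
    rw [← Finset.mem_singleton, ← hu, mem_blockSeeds]
    exact (and_iff_left hw).symm
  have hvj : ∀ w, block w = k → (w ∈ s j ↔ w = v) := fun w hw => by
    rw [← Finset.mem_singleton, ← hv, mem_blockSeeds]
    exact (and_iff_left hw).symm
  have hl' : ∀ l, l ≠ i → l ≠ j → ∀ w ∈ s l, block w ≠ k := fun l h1 h2 w hw hwk => by
    have : w ∈ blockSeeds block s k l := mem_blockSeeds.2 ⟨hw, hwk⟩
    simp [hl l h1 h2] at this
  have huk : block u = k := (mem_blockSeeds.1 (hu ▸ Finset.mem_singleton_self u)).2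
  have hvk : block v = k := (mem_blockSeeds.1 (hv ▸ Finset.mem_singleton_self v)).2
  have hsum := hQ.blockValue_add_le hij (k := k) ⟨i, u, (hui u huk).2 rfl, huk⟩
  rcases le_or_gt (blockValue Q block s i k) (q / 2) with h | h
  · subst hvk
    exact hQ.canImprove_of_duel hij hi hj huk hui hvj hl' h
  · subst huk
    exact hQ.canImprove_of_duel hij.symm hj hi hvk hvj hui (fun l h1 h2 => hl' l h2 h1)
      (by linarith)

/-- A player with two seeds in a block worth at most half improves by moving one of them to an
empty block. -/
lemma canImprove_of_two_seeds {k' : Fin K} (hij : i ≠ j) (hi : (s i).card = b)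
    (hj : (s j).card = b) (hc : 2 ≤ (blockSeeds block s k i).card)
    (hval : blockValue Q block s i k ≤ q / 2) (he : ¬ Hit block s k') : CanImprove Q block b s := by
  obtain ⟨u, hu, v, hv, huv⟩ := Finset.one_lt_card.1 hc
  obtain ⟨hu, huk⟩ := mem_blockSeeds.1 hu
  obtain ⟨hv, hvk⟩ := mem_blockSeeds.1 hv
  refine hQ.canImprove_of_loss_lt_half hij hi hj hu he fun e _ => ?_
  have hpos := hQ.blockValue_pos (s := relocate s i u e) (i := i) (u := v)
    (mem_relocate_self.2 (Or.inr ⟨huv.symm, hv⟩))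
  rw [hvk] at hpos
  rw [huk]
  linarith

/-- A player owning a block with two seeds can improve. -/
lemma canImprove_of_sole_owner (hij : i ≠ j) (hi : (s i).card = b) (hj : (s j).card = b)
    (hb : 1 ≤ b) (hc : 2 ≤ (blockSeeds block s k i).card)
    (hl : ∀ l ≠ i, blockSeeds block s k l = ∅)
    (hsum : ∑ k, ∑ j, (blockSeeds block s k j).card = K + 1) : CanImprove Q block b s := by
  obtain ⟨u, hu, v, hv, huv⟩ := Finset.one_lt_card.1 hc
  obtain ⟨hu, huk⟩ := mem_blockSeeds.1 hu
  obtain ⟨hv, hvk⟩ := mem_blockSeeds.1 hv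
  have hl' : ∀ l ≠ i, ∀ w ∈ s l, block w ≠ k := fun l h w hw hwk => by
    have : w ∈ blockSeeds block s k l := mem_blockSeeds.2 ⟨hw, hwk⟩
    simp [hl l h] at this
  have hval := hQ.blockValue_of_unique_owner hu huk hl'
  have hval' : ∀ e, blockValue Q block (relocate s i u e) i k = q := fun e =>
    hQ.blockValue_of_unique_owner (mem_relocate_self.2 (Or.inr ⟨huv.symm, hv⟩)) hvk
      fun l h w hw => hl' l h w ((mem_relocate_of_ne h).1 hw)
  by_cases hall : ∀ k, Hit block s k
  · obtain ⟨e, hej⟩ : (s j).Nonempty := Finset.card_pos.1 (by omega)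
    refine hQ.canImprove_of_copy hi.le (Or.inl hu) hej (fun w hw hwe => ?_) hall fun _ => ?_
    · have h1 := add_le_of_one_le (fun k => one_le_sum_card_blockSeeds (hall k))
        (hl' j hij.symm e hej).symm
      have h2 := card_blockSeeds_add_le (block := block) (s := s) (k := block e) hij
      have h3 := card_blockSeeds_add_le (block := block) (s := s) (k := k) hij
      have h4 : 0 < (blockSeeds block s (block e) i).card :=
        Finset.card_pos.2 ⟨w, mem_blockSeeds.2 ⟨hw, hwe⟩⟩
      have h5 : 0 < (blockSeeds block s (block e) j).card :=
        Finset.card_pos.2 ⟨e, mem_blockSeeds.2 ⟨hej, rfl⟩⟩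
      omega
    · rw [huk, hval, hval']
  · push Not at hall
    obtain ⟨k', he⟩ := hall
    refine hQ.canImprove_of_loss_lt_half hij hi hj hu he fun e _ => ?_
    have hq : (0 : ℝ) < q := by exact_mod_cast hQ.size_pos
    rw [huk, hval, hval']
    linarith

/-- Two players meeting in a block can improve. -/
lemma canImprove_of_shared_block (hij : i ≠ j) (hs : ∀ i, (s i).card = b)
    (hi : (blockSeeds block s k i).Nonempty) (hj : (blockSeeds block s k j).Nonempty)
    (hsum : ∑ k, ∑ j, (blockSeeds block s k j).card = K + 1) : CanImprove Q block b s := by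
  have hci := Finset.card_pos.2 hi
  have hcj := Finset.card_pos.2 hj
  by_cases hall : ∀ k, Hit block s k
  · have hle := le_of_one_le (fun k => one_le_sum_card_blockSeeds (hall k)) k
    have h2 := card_blockSeeds_add_le (block := block) (s := s) (k := k) hij
    refine hQ.canImprove_of_two_singles (k := k) hij (hs i) (hs j) (by omega) (by omega)
      fun l h1 h2 => ?_
    have := card_blockSeeds_add_add_le (block := block) (s := s) (k := k) hij h1.symm h2.symm
    exact Finset.card_eq_zero.1 (by omega)
  push Not at hall
  obtain ⟨k', he⟩ := hall
  by_cases hlow : ∃ l, (blockSeeds block s k l).Nonempty ∧ blockValue Q block s l k < q / 2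
  · obtain ⟨l, ⟨u, hu⟩, hlt⟩ := hlow
    obtain ⟨l', hl'⟩ : ∃ l', l ≠ l' := by
      by_cases h : l = i
      · exact ⟨j, h ▸ hij⟩
      · exact ⟨i, h⟩
    obtain ⟨hus, huk⟩ := mem_blockSeeds.1 hu
    subst huk
    refine hQ.canImprove_of_loss_lt_half hl' (hs l) (hs l') hus he fun e _ => ?_
    linarith [hQ.blockValue_nonneg (relocate s l u e) l (block u)]
  push Not at hlow
  have hvi := hlow i hi
  have hvj := hlow j hj
  have hk : Hit block s k := by
    obtain ⟨u, hu⟩ := hi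
    exact ⟨i, u, mem_blockSeeds.1 hu⟩
  have hle := hQ.blockValue_add_le hij hk
  rcases Nat.lt_or_ge 1 (blockSeeds block s k i).card with h1 | h1
  · exact hQ.canImprove_of_two_seeds hij (hs i) (hs j) h1 (by linarith) he
  rcases Nat.lt_or_ge 1 (blockSeeds block s k j).card with h2 | h2
  · exact hQ.canImprove_of_two_seeds hij.symm (hs j) (hs i) h2 (by linarith) he
  refine hQ.canImprove_of_two_singles (k := k) hij (hs i) (hs j) (by omega) (by omega)
    fun l hli hlj => ?_
  by_contra hne
  obtain ⟨u, hu⟩ := Finset.nonempty_iff_ne_empty.2 hne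
  linarith [hQ.blockValue_add_lt hij hli.symm hlj.symm hu]

/-- With one block fewer than available seeds, no profile is stable in the limit game. -/
theorem canImprove (hm : 2 ≤ m) (hb : 1 ≤ b) (hK : K + 1 = m * b) (hs : ∀ i, (s i).card ≤ b)
    (hne : (seeded s).Nonempty) : CanImprove Q block b s := by
  have hother : ∀ i : Fin m, ∃ j, i ≠ j := fun i => by
    have : Nontrivial (Fin m) := Fin.nontrivial_iff_two_le.2 hm
    obtain ⟨j, hj⟩ := exists_ne i
    exact ⟨j, hj.symm⟩
  have hcount := sum_sum_card_blockSeeds (block := block) (s := s)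
  have hmb : ∑ _j : Fin m, b = m * b := by simp
  by_cases hfull : ∀ i, (s i).card = b
  · rw [Finset.sum_congr rfl fun j _ => hfull j, hmb, ← hK] at hcount
    obtain ⟨k, hk⟩ : ∃ k, 2 ≤ ∑ j, (blockSeeds block s k j).card := by
      by_contra! h
      have := Finset.sum_le_card_nsmul Finset.univ
        (fun k => ∑ j, (blockSeeds block s k j).card) 1 fun k _ => Nat.lt_succ_iff.1 (h k)
      rw [hcount, Finset.card_univ, Fintype.card_fin, smul_eq_mul] at this
      omega
    obtain ⟨i, hi⟩ : ∃ i, (blockSeeds block s k i).Nonempty := by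
      by_contra! h
      simp [h] at hk
    by_cases hsole : ∀ l ≠ i, blockSeeds block s k l = ∅
    · obtain ⟨j, hij⟩ := hother i
      refine hQ.canImprove_of_sole_owner hij (hfull i) (hfull j) hb ?_ hsole hcount
      rwa [Finset.sum_eq_single i (fun l _ hl => by rw [hsole l hl, Finset.card_empty])
        (by simp)] at hk
    · push Not at hsole
      obtain ⟨j, hj, hne⟩ := hsole
      exact hQ.canImprove_of_shared_block hj.symm hfull hi hne hcount
  · push Not at hfull
    obtain ⟨i₀, hi₀⟩ := hfull
    have hlt₀ : (s i₀).card < b := lt_of_le_of_ne (hs i₀) hi₀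
    obtain ⟨i, j, v, hij, hi, hv⟩ : ∃ i j v, i ≠ j ∧ (s i).card < b ∧ v ∈ s j := by
      by_cases h : ∃ j, i₀ ≠ j ∧ (s j).Nonempty
      · obtain ⟨j, hj, v, hv⟩ := h
        exact ⟨i₀, j, v, hj, hlt₀, hv⟩
      · push Not at h
        obtain ⟨v, hv⟩ := hne
        obtain ⟨l, hl⟩ := mem_seeded.1 hv
        obtain rfl : i₀ = l := by
          by_contra hne
          simp [h l hne] at hl
        obtain ⟨j, hj⟩ := hother i₀
        exact ⟨j, i₀, v, hj.symm, by rw [h j hj, Finset.card_empty]; omega, hl⟩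
    by_cases hall : ∀ k, Hit block s k
    · refine hQ.canImprove_of_copy (u := v) hi.le (Or.inr hi) hv (fun w hw hwv => ?_) hall
        fun h => absurd rfl h
      have h1 := le_of_one_le (fun k => one_le_sum_card_blockSeeds (hall k)) (block v)
      have h2 := card_blockSeeds_add_le (block := block) (s := s) (k := block v) hij
      have h3 : 0 < (blockSeeds block s (block v) i).card :=
        Finset.card_pos.2 ⟨w, mem_blockSeeds.2 ⟨hw, hwv⟩⟩
      have h4 : 0 < (blockSeeds block s (block v) j).card :=
        Finset.card_pos.2 ⟨v, mem_blockSeeds.2 ⟨hv, rfl⟩⟩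
      have h5 : ∑ j, (s j).card < m * b := by
        rw [← hmb]
        exact Finset.sum_lt_sum (fun j _ => hs j) ⟨i, Finset.mem_univ i, hi⟩
      omega
    · push Not at hall
      obtain ⟨k, hk⟩ := hall
      exact hQ.canImprove_of_spare hij hi hv hk

end IsCyclicBlocks

end Improvement

/-! ### Passing to the limits -/

section Limits

open Filter Topology

variable {m n K q : ℕ} {Q : Matrix (Fin n) (Fin n) ℝ} {block : Fin n → Fin K}

lemma sum_blockValue_eq_sum_limitShare (s : Fin m → Finset (Fin n)) (i : Fin m) :
    ∑ k, blockValue Q block s i k = ∑ v, limitShare Q block s i v :=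
  Finset.sum_fiberwise _ _ _

/-- Seed shares are what remains at a block without seeds when blocks interact uniformly. -/
lemma share_eq_seedShare {P : Matrix (Fin n) (Fin n) ℝ} {β : ℝ} (hβ : 0 < β)
    {s : Fin m → Finset (Fin n)} {v : Fin n} (hP : ∀ u, block v ≠ block u → P v u = β)
    (hv : ¬ Hit block s (block v)) (i : Fin m) : share P s i v = seedShare s i := by
  have h : ∀ j, P.mulVec (initOp 0 s j) v = β * ∑ u, initOp 0 s j u := fun j => by
    rw [Matrix.mulVec, dotProduct, Finset.mul_sum]
    refine Finset.sum_congr rfl fun u _ => ?_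
    by_cases hu : u ∈ s j
    · rw [hP u fun h => hv ⟨j, u, hu, h.symm⟩]
    · rw [initOp_zero_of_notMem hu, mul_zero, mul_zero]
  simp only [share, h]
  rw [← Finset.mul_sum, mul_div_mul_left _ _ hβ.ne', sum_sum_initOp_zero, seedShare]

lemma IsCyclicBlocks.tendsto_sum_share (hQ : IsCyclicBlocks Q block q) {ι : Type*} {F : Filter ι}
    {P : ι → Matrix (Fin n) (Fin n) ℝ} (hP : Tendsto P F (𝓝 Q))
    (hβ : ∀ᶠ d in F, ∃ β > 0, ∀ v u, block v ≠ block u → P d v u = β)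
    (s : Fin m → Finset (Fin n)) (i : Fin m) :
    Tendsto (fun d => ∑ v, share (P d) s i v) F (𝓝 (∑ k, blockValue Q block s i k)) := by
  rw [sum_blockValue_eq_sum_limitShare]
  refine tendsto_finsetSum _ fun v _ => ?_
  by_cases hv : Hit block s (block v)
  · rw [limitShare, if_pos hv]
    have h : ∀ j, Tendsto (fun d => (P d).mulVec (initOp 0 s j) v) F
        (𝓝 (Q.mulVec (initOp 0 s j) v)) := fun j => by
      simp only [Matrix.mulVec, dotProduct]
      exact tendsto_finsetSum _ fun u _ =>
        ((tendsto_pi_nhds.1 ((tendsto_pi_nhds.1 hP) v)) u).mul_const _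
    exact (h i).div (tendsto_finsetSum _ fun j _ => h j) (hQ.sum_mass_pos hv).ne'
  · rw [limitShare, if_neg hv]
    refine tendsto_const_nhds.congr' ?_
    filter_upwards [hβ] with d ⟨β, hβ, hd⟩
    exact (share_eq_seedShare hβ (hd v) hv i).symm

lemma mulVec_initOp_zero_nonneg {P : Matrix (Fin n) (Fin n) ℝ} (hP : ∀ v u, 0 < P v u)
    (s : Fin m → Finset (Fin n)) (i : Fin m) (v : Fin n) : 0 ≤ P.mulVec (initOp 0 s i) v := by
  rw [Matrix.mulVec, dotProduct]
  exact Finset.sum_nonneg fun u _ => mul_nonneg (hP v u).le (initOp_zero_nonneg s i u)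

lemma mulVec_initOp_zero_pos {P : Matrix (Fin n) (Fin n) ℝ} (hP : ∀ v u, 0 < P v u)
    {s : Fin m → Finset (Fin n)} {i : Fin m} (hi : (s i).Nonempty) (v : Fin n) :
    0 < P.mulVec (initOp 0 s i) v := by
  obtain ⟨w, hw⟩ := hi
  rw [Matrix.mulVec, dotProduct]
  exact Finset.sum_pos' (fun u _ => mul_nonneg (hP v u).le (initOp_zero_nonneg s i u))
    ⟨w, Finset.mem_univ w, mul_pos (hP v w) (initOp_zero_pos hw)⟩

lemma tendsto_payoff {Γ : Matrix (Fin n) (Fin n) ℝ} {T : ℕ} (hΓ : ∀ v u, 0 < (Γ ^ T) v u)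
    {s : Fin m → Finset (Fin n)} (hs : (seeded s).Nonempty) (i : Fin m) :
    Tendsto (fun ε => payoff Γ T ε s i) (𝓝 0)
      (𝓝 ((1 / (n : ℝ)) * ∑ v, share (Γ ^ T) s i v)) := by
  have hinit : ∀ j u, Tendsto (fun ε => initOp ε s j u) (𝓝 0) (𝓝 (initOp 0 s j u)) := by
    intro j u
    unfold initOp
    split_ifs
    exacts [tendsto_const_nhds, tendsto_const_nhds, tendsto_id]
  have hop : ∀ j v, Tendsto (fun ε => opinion Γ ε s j T v) (𝓝 0)
      (𝓝 ((Γ ^ T).mulVec (initOp 0 s j) v)) := by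
    intro j v
    simp only [opinion, Matrix.mulVec, dotProduct]
    exact tendsto_finsetSum _ fun u _ => (hinit j u).const_mul _
  refine (tendsto_finsetSum _ fun v _ => (hop i v).div
    (tendsto_finsetSum _ fun j _ => hop j v) ?_).const_mul _
  obtain ⟨u, hu⟩ := hs
  obtain ⟨j, hj⟩ := mem_seeded.1 hu
  exact (Finset.sum_pos' (fun l _ => mulVec_initOp_zero_nonneg hΓ s l v)
    ⟨j, Finset.mem_univ j, mulVec_initOp_zero_pos hΓ ⟨u, hj⟩ v⟩).ne'

lemma payoff_of_seeded_eq_empty {Γ : Matrix (Fin n) (Fin n) ℝ} {T : ℕ} (hn : 0 < n) (hm : 0 < m)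
    (hΓ : ∀ v u, 0 < (Γ ^ T) v u) {s : Fin m → Finset (Fin n)} (hs : seeded s = ∅) {ε : ℝ}
    (hε : 0 < ε) (i : Fin m) : payoff Γ T ε s i = 1 / m := by
  have hinit : ∀ j, initOp ε s j = fun _ => ε := fun j => by
    ext u
    have : u ∉ s j := fun h => by
      have := mem_seeded.2 ⟨j, h⟩
      simp [hs] at this
    simp [initOp, this, hs]
  have hpos : ∀ v, 0 < (Γ ^ T).mulVec (fun _ => ε) v := fun v =>
    Finset.sum_pos (fun u _ => mul_pos (hΓ v u) hε) ⟨⟨0, hn⟩, Finset.mem_univ _⟩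
  have hshare : ∀ v, (Γ ^ T).mulVec (fun _ => ε) v / ∑ _j : Fin m, (Γ ^ T).mulVec (fun _ => ε) v
      = 1 / m := fun v => by
    rw [Finset.sum_const, Finset.card_univ, Fintype.card_fin, nsmul_eq_mul]
    have := hpos v
    have hm' : (0 : ℝ) < m := by exact_mod_cast hm
    field_simp
  have hn' : (0 : ℝ) < n := by exact_mod_cast hn
  simp only [payoff, opinion, hinit, hshare]
  simp only [Finset.sum_const, Finset.card_univ, Fintype.card_fin, nsmul_eq_mul]
  field_simp

lemma sum_share_of_sole_player {P : Matrix (Fin n) (Fin n) ℝ} (hP : ∀ v u, 0 < P v u)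
    {s : Fin m → Finset (Fin n)} {i : Fin m} (hi : (s i).Nonempty) (hs : ∀ j ≠ i, s j = ∅) :
    ∑ v, share P s i v = n := by
  have h : ∀ v, share P s i v = 1 := fun v => by
    rw [share, Finset.sum_eq_single i, div_self (mulVec_initOp_zero_pos hP hi v).ne']
    · intro j _ hj
      rw [Matrix.mulVec, dotProduct]
      exact Finset.sum_eq_zero fun u _ => by
        rw [initOp_zero_of_notMem (by simp [hs j hj]), mul_zero]
    · simp
  simp [h]

/-- If every profile with a seed is unstable for vanishing `ε`, then for small `ε` there is no
equilibrium. -/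
lemma exists_threshold {Γ : Matrix (Fin n) (Fin n) ℝ} {T b : ℕ} (hn : 0 < n) (hm : 2 ≤ m)
    (hb : 1 ≤ b) (hΓ : ∀ v u, 0 < (Γ ^ T) v u)
    (h : ∀ s : Fin m → Finset (Fin n), (∀ i, (s i).card ≤ b) → (seeded s).Nonempty →
      ∃ (i : Fin m) (s' : Finset (Fin n)), s'.card ≤ b ∧
        ∑ v, share (Γ ^ T) s i v < ∑ v, share (Γ ^ T) (Function.update s i s') i v) :
    ∃ ε₀ : ℝ, 0 < ε₀ ∧ ε₀ < 1 / (m : ℝ) ∧ ∀ ε : ℝ, 0 < ε → ε < ε₀ →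
      ¬ ∃ s : Fin m → Finset (Fin n), (∀ i, (s i).card ≤ b) ∧
        ∀ (i : Fin m) (s' : Finset (Fin n)), s'.card ≤ b →
          payoff Γ T ε (Function.update s i s') i ≤ payoff Γ T ε s i := by
  have hn' : (0 : ℝ) < n := by exact_mod_cast hn
  have hm' : (2 : ℝ) ≤ m := by exact_mod_cast hm
  have key : ∀ s : Fin m → Finset (Fin n), ∀ᶠ ε in 𝓝[>] (0 : ℝ), (∀ i, (s i).card ≤ b) →
      ∃ (i : Fin m) (s' : Finset (Fin n)), s'.card ≤ b ∧
        payoff Γ T ε s i < payoff Γ T ε (Function.update s i s') i := by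
    intro s
    by_cases hs : ∀ i, (s i).card ≤ b
    swap
    · exact Eventually.of_forall fun ε h => absurd h hs
    rcases (seeded s).eq_empty_or_nonempty with he | hne
    · set i : Fin m := ⟨0, by omega⟩
      set v : Fin n := ⟨0, hn⟩
      have hempty : ∀ j, s j = ∅ := fun j => by
        rw [Finset.eq_empty_iff_forall_notMem]
        intro u hu
        have := mem_seeded.2 ⟨j, hu⟩
        simp [he] at this
      have hlim := tendsto_payoff hΓ (s := Function.update s i {v})
        ⟨v, mem_seeded.2 ⟨i, by simp⟩⟩ i
      rw [sum_share_of_sole_player hΓ (by simp) (fun j hj => by simp [hj, hempty]),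
        one_div_mul_cancel hn'.ne'] at hlim
      have hlt : 1 / (m : ℝ) < 1 := by
        rw [div_lt_one (by linarith)]
        linarith
      filter_upwards [nhdsWithin_le_nhds (hlim.eventually_const_lt hlt), self_mem_nhdsWithin]
        with ε hε hε0 _
      refine ⟨i, {v}, by simpa using hb, ?_⟩
      rwa [payoff_of_seeded_eq_empty hn (by omega) hΓ he hε0]
    · obtain ⟨i, s', hs', hlt⟩ := h s hs hne
      by_cases hne' : (seeded (Function.update s i s')).Nonempty
      · filter_upwards [nhdsWithin_le_nhds ((tendsto_payoff hΓ hne i).eventually_lt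
          (tendsto_payoff hΓ hne' i) (by gcongr))] with ε hε _
        exact ⟨i, s', hs', hε⟩
      · have hzero : ∀ u, initOp 0 (Function.update s i s') i u = 0 := fun u =>
          initOp_zero_of_notMem fun hu => hne' ⟨u, mem_seeded.2 ⟨i, hu⟩⟩
        have hle : ∑ v, share (Γ ^ T) (Function.update s i s') i v = 0 :=
          Finset.sum_eq_zero fun v _ => by simp [share, Matrix.mulVec, dotProduct, hzero]
        have hge : 0 ≤ ∑ v, share (Γ ^ T) s i v := Finset.sum_nonneg fun v _ =>
          div_nonneg (mulVec_initOp_zero_nonneg hΓ s i v)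
            (Finset.sum_nonneg fun j _ => mulVec_initOp_zero_nonneg hΓ s j v)
        linarith
  obtain ⟨r, hr, hsub⟩ := mem_nhdsGT_iff_exists_Ioo_subset.1 (eventually_all.2 key)
  have hr : 0 < r := hr
  refine ⟨min r (1 / (2 * m)), by positivity, ?_, fun ε h0 hε => ?_⟩
  · refine (min_le_right _ _).trans_lt ?_
    exact one_div_lt_one_div_of_lt (by linarith) (by linarith)
  · rintro ⟨s, hs, hnash⟩
    obtain ⟨i, s', hs', hlt⟩ := hsub ⟨h0, hε.trans_le (min_le_left _ _)⟩ s hs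
    exact (hnash i s' hs').not_gt hlt

end Limits

/-! ### Construction of the network -/

section Construction

open Filter Topology

/-- The circulant matrix with first row `(a, b, c)`. -/
def cyc (a b c : ℝ) : Matrix (Fin 3) (Fin 3) ℝ :=
  !![a, b, c; c, a, b; b, c, a]

lemma cyc_mul (a b c a' b' c' : ℝ) : cyc a b c * cyc a' b' c' =
    cyc (a * a' + b * c' + c * b') (a * b' + b * a' + c * c') (a * c' + b * b' + c * a') := by
  ext i j
  fin_cases i <;> fin_cases j <;> simp [cyc, Matrix.mul_apply, Fin.sum_univ_three] <;> ring

lemma one_eq_cyc : (1 : Matrix (Fin 3) (Fin 3) ℝ) = cyc 1 0 0 := by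
  ext i j
  fin_cases i <;> fin_cases j <;> simp [cyc]

lemma cyc_pow_aux {τ : ℝ} {B : ℕ} (hτ : 0 < τ) (hB : 12 * τ * B ≤ 1) (t : ℕ) (ht : t ≤ B) :
    ∃ a b c, cyc (1 - 3 * τ) (2 * τ) τ ^ t = cyc a b c ∧ 0 ≤ c ∧ c ≤ b ∧ a + b + c = 1 ∧
      1 - 6 * τ * t ≤ a - b := by
  induction t with
  | zero => exact ⟨1, 0, 0, by rw [pow_zero, one_eq_cyc], by norm_num⟩
  | succ t ih =>
    obtain ⟨a, b, c, h, hc, hcb, hsum, hab⟩ := ih (by omega)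
    have ht' : (t : ℝ) + 1 ≤ B := by exact_mod_cast ht
    have h1 : 12 * τ * (t + 1) ≤ 1 := by nlinarith
    have ht0 : 0 ≤ τ * t := by positivity
    refine ⟨_, _, _, by rw [pow_succ, h, cyc_mul], ?_, ?_, ?_, ?_⟩
    · have : 0 ≤ c * (1 - 3 * τ) := mul_nonneg hc (by nlinarith)
      nlinarith
    · nlinarith [mul_nonneg (sub_nonneg.2 hcb) (show 0 ≤ 1 - 4 * τ by nlinarith)]
    · linear_combination hsum
    · push_cast
      nlinarith

/-- The powers of a lazy circulant matrix have strictly ordered positive entries. -/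
lemma exists_cyc_pow {τ : ℝ} {B : ℕ} (hB : 1 ≤ B) (hτ : 0 < τ) (hτB : 12 * τ * B ≤ 1) :
    ∃ a b c, cyc (1 - 3 * τ) (2 * τ) τ ^ B = cyc a b c ∧ 0 < c ∧ c < b ∧ b < a := by
  obtain ⟨t, rfl⟩ := Nat.exists_eq_add_of_le' hB
  obtain ⟨a, b, c, h, hc, hcb, hsum, hab⟩ := cyc_pow_aux hτ hτB t (by omega)
  push_cast at hτB
  have ht0 : 0 ≤ τ * t := by positivity
  have hab' : 1 / 2 ≤ a - b := by nlinarith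
  refine ⟨_, _, _, by rw [pow_succ, h, cyc_mul], ?_, ?_, ?_⟩
  · have : 0 ≤ c * (1 - 3 * τ) := mul_nonneg hc (by nlinarith)
    nlinarith
  · nlinarith [mul_nonneg (sub_nonneg.2 hcb) (show 0 ≤ 1 - 4 * τ by nlinarith)]
  · nlinarith

lemma three_halves_lt {a b c : ℝ} (hc : 0 < c) (hcb : c < b) (hba : b < a) :
    3 / 2 < a / (a + b) + b / (b + c) + c / (c + a) := by
  have hb : 0 < b := hc.trans hcb
  have ha : 0 < a := hb.trans hba
  have h : a / (a + b) + b / (b + c) + c / (c + a) - 3 / 2 =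
      (a - b) * (b - c) * (a - c) / (2 * (a + b) * (b + c) * (c + a)) := by
    field_simp
    ring
  have : 0 < (a - b) * (b - c) * (a - c) / (2 * (a + b) * (b + c) * (c + a)) := by
    have h1 := sub_pos.2 hba
    have h2 := sub_pos.2 hcb
    have h3 := sub_pos.2 (hcb.trans hba)
    positivity
  linarith

lemma cyc_beaten {a b c : ℝ} (hc : 0 < c) (hcb : c < b) (hba : b < a) (p : Fin 3) :
    ∃ p', 3 / 2 < ∑ r, cyc a b c r p' / (cyc a b c r p' + cyc a b c r p) := by
  refine ⟨p + 2, ?_⟩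
  have h := three_halves_lt hc hcb hba
  fin_cases p <;> simp [cyc, Fin.sum_univ_three] <;> linarith

lemma cyc_pos {a b c : ℝ} (hc : 0 < c) (hcb : c < b) (hba : b < a) (p r : Fin 3) :
    0 < cyc a b c p r := by
  have hb : 0 < b := hc.trans hcb
  have ha : 0 < a := hb.trans hba
  fin_cases p <;> fin_cases r <;> simpa [cyc]

/-- `K` disjoint copies of the network `C` on three nodes. -/
def copies (K : ℕ) (C : Matrix (Fin 3) (Fin 3) ℝ) : Matrix (Fin (3 * K)) (Fin (3 * K)) ℝ :=
  Matrix.reindexAlgEquiv ℝ ℝ finProdFinEquiv (Matrix.blockDiagonal fun _ : Fin K => C)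

/-- The copy to which a node belongs. -/
def copyIndex {K : ℕ} (v : Fin (3 * K)) : Fin K :=
  (finProdFinEquiv.symm v).2

variable {K : ℕ}

lemma copies_pow (C : Matrix (Fin 3) (Fin 3) ℝ) (t : ℕ) : copies K C ^ t = copies K (C ^ t) := by
  rw [copies, copies, ← map_pow, ← Matrix.blockDiagonal_pow]
  rfl

lemma copies_apply (C : Matrix (Fin 3) (Fin 3) ℝ) (p r : Fin 3) (k l : Fin K) :
    copies K C (finProdFinEquiv (p, k)) (finProdFinEquiv (r, l)) = if k = l then C p r else 0 := by
  simp [copies, Matrix.blockDiagonal_apply]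

lemma copies_apply_of_ne (C : Matrix (Fin 3) (Fin 3) ℝ) {v u : Fin (3 * K)}
    (h : copyIndex v ≠ copyIndex u) : copies K C v u = 0 := by
  simp only [copies, Matrix.coe_reindexAlgEquiv, Matrix.reindex_apply, Matrix.submatrix_apply,
    Matrix.blockDiagonal_apply]
  exact if_neg h

lemma copies_apply_of_eq (C : Matrix (Fin 3) (Fin 3) ℝ) {v u : Fin (3 * K)}
    (h : copyIndex v = copyIndex u) :
    copies K C v u = C (finProdFinEquiv.symm v).1 (finProdFinEquiv.symm u).1 := by
  simp only [copies, Matrix.coe_reindexAlgEquiv, Matrix.reindex_apply, Matrix.submatrix_apply,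
    Matrix.blockDiagonal_apply]
  exact if_pos h

lemma copyIndex_apply (p : Fin 3) (k : Fin K) : copyIndex (finProdFinEquiv (p, k)) = k := by
  simp [copyIndex]

lemma forall_node {P : Fin (3 * K) → Prop} : (∀ v, P v) ↔ ∀ p k, P (finProdFinEquiv (p, k)) := by
  rw [← finProdFinEquiv.forall_congr_right, Prod.forall]

lemma sum_node {M : Type*} [AddCommMonoid M] (f : Fin (3 * K) → M) :
    ∑ v, f v = ∑ k, ∑ p, f (finProdFinEquiv (p, k)) := by
  rw [← Equiv.sum_comp finProdFinEquiv, Fintype.sum_prod_type_right]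

lemma sum_copyIndex_eq {M : Type*} [AddCommMonoid M] (f : Fin (3 * K) → M) (k : Fin K) :
    ∑ v with copyIndex v = k, f v = ∑ p, f (finProdFinEquiv (p, k)) := by
  rw [Finset.sum_filter, sum_node]
  simp only [copyIndex_apply]
  rw [Finset.sum_eq_single k (fun l _ hl => by simp [hl]) (by simp)]
  simp

lemma isCyclicBlocks_copies {a b c : ℝ} (hc : 0 < c) (hcb : c < b) (hba : b < a) :
    IsCyclicBlocks (copies K (cyc a b c)) copyIndex 3 where
  pos h := by
    rw [copies_apply_of_eq _ h]
    exact cyc_pos hc hcb hba _ _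
  zero h := copies_apply_of_ne _ h
  size_pos := by norm_num
  size k := by
    rw [Finset.card_eq_sum_ones, sum_copyIndex_eq]
    simp
  beaten := by
    refine forall_node.2 fun p k => ?_
    obtain ⟨p', h⟩ := cyc_beaten hc hcb hba p
    refine ⟨finProdFinEquiv (p', k), by rw [copyIndex_apply, copyIndex_apply], ?_⟩
    rw [copyIndex_apply, sum_copyIndex_eq]
    simpa [copies_apply] using h

/-- Powers of a convex combination of `X` with an idempotent absorbing `X`. -/
lemma mix_pow {R : Type*} [Ring R] [Algebra ℝ R] {X J : R} (hXJ : X * J = J) (hJX : J * X = J)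
    (hJ : J * J = J) (d : ℝ) (t : ℕ) :
    ((1 - d) • X + d • J) ^ t = (1 - d) ^ t • X ^ t + (1 - (1 - d) ^ t) • J := by
  have hpow : ∀ t : ℕ, X ^ t * J = J := fun t => by
    induction t with
    | zero => simp
    | succ t ih => rw [pow_succ, mul_assoc, hXJ, ih]
  induction t with
  | zero => simp
  | succ t ih =>
    rw [pow_succ, ih]
    simp only [add_mul, mul_add, smul_mul_smul_comm, hpow, hJX, hJ, ← pow_succ]
    module

/-- The uniform averaging matrix. -/
noncomputable def averaging (n : ℕ) : Matrix (Fin n) (Fin n) ℝ :=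
  Matrix.of fun _ _ => 1 / (n : ℝ)

lemma averaging_mul_self {n : ℕ} (hn : 0 < n) : averaging n * averaging n = averaging n := by
  have : (0 : ℝ) < n := by exact_mod_cast hn
  ext i j
  simp [averaging, Matrix.mul_apply]
  field_simp

lemma mul_averaging {n : ℕ} {X : Matrix (Fin n) (Fin n) ℝ} (h : ∀ v, ∑ u, X v u = 1) :
    X * averaging n = averaging n := by
  ext i j
  simp [averaging, Matrix.mul_apply, ← Finset.sum_mul, h]

lemma averaging_mul {n : ℕ} {X : Matrix (Fin n) (Fin n) ℝ} (h : ∀ u, ∑ v, X v u = 1) :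
    averaging n * X = averaging n := by
  ext i j
  simp [averaging, Matrix.mul_apply, ← Finset.mul_sum, h]

lemma copies_row_sum {C : Matrix (Fin 3) (Fin 3) ℝ} (h : ∀ p, ∑ r, C p r = 1) (v : Fin (3 * K)) :
    ∑ u, copies K C v u = 1 := by
  revert v
  refine forall_node.2 fun p k => ?_
  rw [sum_node, Finset.sum_eq_single k]
  · simpa [copies_apply] using h p
  · intro l _ hl
    simp [copies_apply, hl.symm]
  · simp

lemma copies_col_sum {C : Matrix (Fin 3) (Fin 3) ℝ} (h : ∀ r, ∑ p, C p r = 1) (u : Fin (3 * K)) :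
    ∑ v, copies K C v u = 1 := by
  revert u
  refine forall_node.2 fun p k => ?_
  rw [sum_node, Finset.sum_eq_single k]
  · simpa [copies_apply] using h p
  · intro l _ hl
    simp [copies_apply, hl]
  · simp

/-- Lazy copies of a three-cycle, coupled uniformly with strength `d`. -/
noncomputable def coupled (K : ℕ) (τ d : ℝ) : Matrix (Fin (3 * K)) (Fin (3 * K)) ℝ :=
  (1 - d) • copies K (cyc (1 - 3 * τ) (2 * τ) τ) + d • averaging (3 * K)

variable {τ d : ℝ}

lemma lazy_row_sum (τ : ℝ) (p : Fin 3) : ∑ r, cyc (1 - 3 * τ) (2 * τ) τ p r = 1 := by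
  fin_cases p <;> simp [cyc, Fin.sum_univ_three] <;> ring

lemma lazy_col_sum (τ : ℝ) (r : Fin 3) : ∑ p, cyc (1 - 3 * τ) (2 * τ) τ p r = 1 := by
  fin_cases r <;> simp [cyc, Fin.sum_univ_three] <;> ring

lemma coupled_pow (hK : 0 < K) (τ d : ℝ) (t : ℕ) : coupled K τ d ^ t =
    (1 - d) ^ t • copies K (cyc (1 - 3 * τ) (2 * τ) τ ^ t) +
      (1 - (1 - d) ^ t) • averaging (3 * K) := by
  rw [coupled, mix_pow (mul_averaging (copies_row_sum (lazy_row_sum τ)))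
    (averaging_mul (copies_col_sum (lazy_col_sum τ))) (averaging_mul_self (by omega)), copies_pow]

lemma coupled_row_sum (hK : 0 < K) (τ d : ℝ) (v : Fin (3 * K)) : ∑ u, coupled K τ d v u = 1 := by
  have hn : (0 : ℝ) < K := by exact_mod_cast hK
  simp only [coupled, Matrix.add_apply, Matrix.smul_apply, smul_eq_mul, Finset.sum_add_distrib,
    ← Finset.mul_sum, copies_row_sum (lazy_row_sum τ)]
  simp [averaging]
  field_simp
  ring

lemma copies_lazy_nonneg (hτ : 0 < τ) (hτ' : 12 * τ ≤ 1) (v u : Fin (3 * K)) :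
    0 ≤ copies K (cyc (1 - 3 * τ) (2 * τ) τ) v u := by
  revert v u
  refine forall_node.2 fun p k => forall_node.2 fun r l => ?_
  rw [copies_apply]
  split_ifs
  · exact (cyc_pos hτ (by linarith) (by linarith) p r).le
  · rfl

lemma coupled_pos (hτ : 0 < τ) (hτ' : 12 * τ ≤ 1) (hd : 0 < d) (hd' : d ≤ 1 / 3)
    (v u : Fin (3 * K)) : 0 < coupled K τ d v u := by
  have hn : (0 : ℝ) < (3 * K : ℕ) := by exact_mod_cast v.pos
  have h1 := mul_nonneg (show 0 ≤ 1 - d by linarith) (copies_lazy_nonneg hτ hτ' v u)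
  have h2 : 0 < d * (1 / ((3 * K : ℕ) : ℝ)) := by positivity
  simp only [coupled, averaging, Matrix.add_apply, Matrix.smul_apply, smul_eq_mul, Matrix.of_apply]
  linarith

lemma half_le_coupled_self (hτ' : 12 * τ ≤ 1) (hd : 0 < d) (hd' : d ≤ 1 / 3)
    (v : Fin (3 * K)) : 1 / 2 ≤ coupled K τ d v v := by
  have hn : (0 : ℝ) < (3 * K : ℕ) := by exact_mod_cast v.pos
  have h1 : copies K (cyc (1 - 3 * τ) (2 * τ) τ) v v = 1 - 3 * τ := by
    rw [copies_apply_of_eq _ rfl]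
    generalize (finProdFinEquiv.symm v).1 = p
    fin_cases p <;> simp [cyc]
  have h2 : 0 < d * (1 / ((3 * K : ℕ) : ℝ)) := by positivity
  simp only [coupled, averaging, Matrix.add_apply, Matrix.smul_apply, smul_eq_mul, Matrix.of_apply,
    h1]
  nlinarith

lemma tendsto_coupled_pow (hK : 0 < K) (τ : ℝ) (t : ℕ) :
    Tendsto (fun d => coupled K τ d ^ t) (𝓝[>] 0)
      (𝓝 (copies K (cyc (1 - 3 * τ) (2 * τ) τ ^ t))) := by
  have h : Continuous fun d => coupled K τ d ^ t := by
    unfold coupled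
    fun_prop
  have h0 := h.tendsto 0
  simp only [coupled_pow hK, sub_zero, one_pow, one_smul, sub_self, zero_smul, add_zero] at h0 ⊢
  exact h0.mono_left nhdsWithin_le_nhds

lemma coupled_pow_of_ne (hK : 0 < K) (τ d : ℝ) (t : ℕ) {v u : Fin (3 * K)}
    (h : copyIndex v ≠ copyIndex u) :
    (coupled K τ d ^ t) v u = (1 - (1 - d) ^ t) * (1 / ((3 * K : ℕ) : ℝ)) := by
  simp [coupled_pow hK, averaging, copies_apply_of_ne _ h]

lemma pow_pos_apply {n : ℕ} {Γ : Matrix (Fin n) (Fin n) ℝ} (h : ∀ v u, 0 < Γ v u) {t : ℕ}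
    (ht : 1 ≤ t) (v u : Fin n) : 0 < (Γ ^ t) v u := by
  obtain ⟨t, rfl⟩ := Nat.exists_eq_add_of_le' ht
  clear ht
  induction t generalizing v u with
  | zero => simpa using h v u
  | succ t ih =>
    rw [pow_succ, Matrix.mul_apply]
    exact Finset.sum_pos (fun w _ => mul_pos (ih v w) (h w u)) ⟨v, Finset.mem_univ v⟩

/-- For a suitable coupling strength, every seeded profile is unstable at `ε = 0`. -/
lemma exists_coupling {m b : ℕ} (hm : 2 ≤ m) (hb : 1 ≤ b) (hK : K + 1 = m * b) (hK0 : 0 < K)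
    (hτ : 0 < τ) (hτb : 12 * τ * b ≤ 1) :
    ∃ d : ℝ, 0 < d ∧ d ≤ 1 / 3 ∧ ∀ s : Fin m → Finset (Fin (3 * K)), (∀ i, (s i).card ≤ b) →
      (seeded s).Nonempty → ∃ (i : Fin m) (s' : Finset (Fin (3 * K))), s'.card ≤ b ∧
        ∑ v, share (coupled K τ d ^ b) s i v <
          ∑ v, share (coupled K τ d ^ b) (Function.update s i s') i v := by
  obtain ⟨x, y, z, hpow, hz, hzy, hyx⟩ := exists_cyc_pow hb hτ hτb
  have hQ := isCyclicBlocks_copies (K := K) hz hzy hyx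
  have hlim := tendsto_coupled_pow hK0 τ b
  rw [hpow] at hlim
  have hrange : ∀ᶠ d in 𝓝[>] (0 : ℝ), 0 < d ∧ d < 1 / 3 :=
    Ioo_mem_nhdsGT (by norm_num)
  have hβ : ∀ᶠ d in 𝓝[>] (0 : ℝ), ∃ β > 0, ∀ v u : Fin (3 * K), copyIndex v ≠ copyIndex u →
      (coupled K τ d ^ b) v u = β := by
    filter_upwards [hrange] with d hd
    refine ⟨_, ?_, fun v u => coupled_pow_of_ne hK0 τ d b⟩
    have h1 : (1 - d) ^ b < 1 := pow_lt_one₀ (by linarith) (by linarith) (by omega)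
    have h2 : (0 : ℝ) < (3 * K : ℕ) := by exact_mod_cast (by omega : 0 < 3 * K)
    have h3 : 0 < 1 - (1 - d) ^ b := by linarith
    positivity
  have key : ∀ s : Fin m → Finset (Fin (3 * K)), ∀ᶠ d in 𝓝[>] (0 : ℝ), (∀ i, (s i).card ≤ b) →
      (seeded s).Nonempty → ∃ (i : Fin m) (s' : Finset (Fin (3 * K))), s'.card ≤ b ∧
        ∑ v, share (coupled K τ d ^ b) s i v <
          ∑ v, share (coupled K τ d ^ b) (Function.update s i s') i v := by
    intro s
    by_cases hs : (∀ i, (s i).card ≤ b) ∧ (seeded s).Nonempty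
    · obtain ⟨i, s', hs', hlt⟩ := hQ.canImprove hm hb hK hs.1 hs.2
      filter_upwards [(hQ.tendsto_sum_share hlim hβ s i).eventually_lt
        (hQ.tendsto_sum_share hlim hβ (Function.update s i s') i) hlt] with d hd _ _
      exact ⟨i, s', hs', hd⟩
    · exact Eventually.of_forall fun d h1 h2 => absurd ⟨h1, h2⟩ hs
  obtain ⟨d, hd, h⟩ := (hrange.and (eventually_all.2 key)).exists
  exact ⟨d, hd.1, hd.2.le, h⟩

end Construction

/-- Proposition 2: for every number of players `m ≥ 2` and every symmetric seed budget
`b ≥ 1`, there is a network influence game (a strongly connected weighted digraph whose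
incoming weights sum to one at every node, together with `α = 1/2`, `T = b`, and any
sufficiently small `ε`) admitting no pure Nash equilibrium. -/
theorem exists_game_without_pure_nash (m b : ℕ) (hm : 2 ≤ m) (hb : 1 ≤ b) :
    ∃ (n : ℕ) (A : Matrix (Fin n) (Fin n) ℝ) (ε₀ : ℝ),
      0 < n ∧
      (∀ u v, 0 ≤ A u v) ∧
      (∀ v : Fin n, ∑ u : Fin n, A u v = 1) ∧
      (∀ u v : Fin n, Relation.ReflTransGen (fun a b : Fin n => 0 < A a b) u v) ∧
      0 < ε₀ ∧ ε₀ < 1 / (m : ℝ) ∧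
      ∀ ε : ℝ, 0 < ε → ε < ε₀ →
        ¬ ∃ s : Fin m → Finset (Fin n),
            (∀ i, (s i).card ≤ b) ∧
            ∀ (i : Fin m) (s' : Finset (Fin n)), s'.card ≤ b →
              payoff ((1 / 2 : ℝ) • (1 : Matrix (Fin n) (Fin n) ℝ) + (1 / 2 : ℝ) • Aᵀ)
                  b ε (Function.update s i s') i ≤
                payoff ((1 / 2 : ℝ) • (1 : Matrix (Fin n) (Fin n) ℝ) + (1 / 2 : ℝ) • Aᵀ)
                  b ε s i := by
  have hmb : 2 * 1 ≤ m * b := Nat.mul_le_mul hm hb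
  obtain ⟨K, hK⟩ : ∃ K, K + 1 = m * b := ⟨m * b - 1, by omega⟩
  have hK0 : 0 < K := by omega
  have hb' : (1 : ℝ) ≤ b := by exact_mod_cast hb
  set τ : ℝ := 1 / (12 * b) with hτ_def
  have hτ : 0 < τ := by positivity
  have hτb : 12 * τ * b = 1 := by rw [hτ_def]; field_simp
  have hτ' : 12 * τ ≤ 1 := by nlinarith
  obtain ⟨d, hd, hd', himp⟩ := exists_coupling hm hb hK hK0 hτ hτb.le
  have hpos := coupled_pos (K := K) hτ hτ' hd hd'
  have hn : 0 < 3 * K := by omega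
  obtain ⟨ε₀, hε₀, hε₀', hfinal⟩ := exists_threshold hn hm hb (pow_pos_apply hpos hb) himp
  set A : Matrix (Fin (3 * K)) (Fin (3 * K)) ℝ := ((2 : ℝ) • coupled K τ d - 1)ᵀ with hA
  have hΓ : (1 / 2 : ℝ) • (1 : Matrix (Fin (3 * K)) (Fin (3 * K)) ℝ) + (1 / 2 : ℝ) • Aᵀ =
      coupled K τ d := by
    rw [hA, Matrix.transpose_transpose]
    module
  have hself : ∀ v, 0 ≤ A v v := fun v => by
    have := half_le_coupled_self hτ' hd hd' v
    simp only [hA, Matrix.transpose_apply, Matrix.sub_apply, Matrix.smul_apply, smul_eq_mul,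
      Matrix.one_apply_eq]
    linarith
  have hne : ∀ u v, u ≠ v → 0 < A u v := fun u v h => by
    simp only [hA, Matrix.transpose_apply, Matrix.sub_apply, Matrix.smul_apply, smul_eq_mul,
      Matrix.one_apply_ne h.symm]
    linarith [hpos v u]
  refine ⟨3 * K, A, ε₀, hn, fun u v => ?_, fun v => ?_, fun u v => ?_, hε₀, hε₀', ?_⟩
  · rcases eq_or_ne u v with rfl | h
    exacts [hself u, (hne u v h).le]
  · simp only [hA, Matrix.transpose_apply, Matrix.sub_apply, Matrix.smul_apply, smul_eq_mul,
      Finset.sum_sub_distrib, ← Finset.mul_sum, coupled_row_sum hK0]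
    simp [Matrix.one_apply]
    norm_num
  · rcases eq_or_ne u v with rfl | h
    exacts [Relation.ReflTransGen.refl, Relation.ReflTransGen.single (hne u v h)]
  · rw [hΓ]
    exact hfinal
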